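/- For the Weyl group W₀ of type B₂ (the dihedral group of order 8 acting on E = ℝ²), the elliptic pairing e_{W₀} on the five irreducible characters ε₀, ε₁, ε₂, ε₃, E satisfies: e(ε₀,ε₀)=e(ε₃,ε₃)=e(ε₀,ε₃)=1, e(ε₁,ε₁)=e(ε₂,ε₂)=e(ε₁,ε₂)=1, e(ε₀,ε₁)=e(ε₀,ε₂)=e(ε₁,ε₃)=e(ε₂,ε₃)=0, e(ε_i,E)=−1 for all i, and e(E,E)=2. In particular the space Ell(W₀) has dimension 2. -/

import Mathlib

/- STATEMENT 18: the elliptic pairing table for the Weyl group W₀ of type B₂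
(dihedral of order 8 acting on ℝ²), and dim Ell(W₀) = 2. -/

open scoped Classical Matrix

noncomputable section

/-- The reflection `s₁` in `α₁ = (1,-1)` (coordinate swap). -/
def S1mat : Matrix (Fin 2) (Fin 2) ℝ := !![0, 1; 1, 0]

/-- The reflection `s₂` in `α₂ = (0,1)`. -/
def S2mat : Matrix (Fin 2) (Fin 2) ℝ := !![1, 0; 0, -1]

lemma S1_inv : S1mat * S1mat = 1 := by
  ext i j
  fin_cases i <;> fin_cases j <;>
    norm_num [S1mat, Matrix.mul_apply, Fin.sum_univ_two]

lemma S2_inv : S2mat * S2mat = 1 := by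
  ext i j
  fin_cases i <;> fin_cases j <;>
    norm_num [S2mat, Matrix.mul_apply, Fin.sum_univ_two]

/-- `s₁` as an invertible matrix. -/
def S1 : GL (Fin 2) ℝ := ⟨S1mat, S1mat, S1_inv, S1_inv⟩

/-- `s₂` as an invertible matrix. -/
def S2 : GL (Fin 2) ℝ := ⟨S2mat, S2mat, S2_inv, S2_inv⟩

/-- The Weyl group `W₀` of type `B₂`: the dihedral group of order 8 generated
by the two simple reflections, acting on `E = ℝ²`. -/
def W0 : Subgroup (GL (Fin 2) ℝ) := Subgroup.closure {S1, S2}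

/-- `s₁ ∈ W₀`. -/
def a : ↥W0 := ⟨S1, Subgroup.subset_closure (Set.mem_insert _ _)⟩

/-- `s₂ ∈ W₀`. -/
def b : ↥W0 := ⟨S2, Subgroup.subset_closure (Set.mem_insert_of_mem _ rfl)⟩

/-- The eight elements `{e, s₁, s₂, s₃, s₄, ρ_{π/2}, ρ_π, ρ_{-π/2}}` of `W₀`,
written as words in the generators. -/
def elems : List ↥W0 := [1, a, b, a * b, b * a, a * b * a, b * a * b, a * b * a * b]

/-- The underlying matrix of an element of `W₀`. -/
def mat (g : ↥W0) : Matrix (Fin 2) (Fin 2) ℝ := ((g : GL (Fin 2) ℝ) : Matrix (Fin 2) (Fin 2) ℝ)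

/-- The trivial character `ε₀`. -/
def eps0 : ↥W0 → ℂ := fun _ => 1
/-- The character `ε₁` (`+1` on `{s₂,s₃}`-type reflections, `−1` on
`{s₁,s₄}`-type reflections). -/
def eps1 : ↥W0 → ℂ := fun g => (((mat g 0 0) ^ 2 - (mat g 0 1) ^ 2 : ℝ) : ℂ)
/-- The determinant character `ε₃`. -/
def eps3 : ↥W0 → ℂ := fun g => (((mat g).det : ℝ) : ℂ)
/-- The character `ε₂ = ε₁ ε₃`. -/
def eps2 : ↥W0 → ℂ := fun g => eps1 g * eps3 g
/-- The character of the two-dimensional reflection representation `E`. -/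
def chiE : ↥W0 → ℂ := fun g => (((mat g).trace : ℝ) : ℂ)

/-- The elliptic pairing
`e_{W₀}(χ,χ′) = |W₀|⁻¹ Σ_γ det(id_E − γ) conj(χ(γ)) χ′(γ)`. -/
def eB2 (f f' : ↥W0 → ℂ) : ℂ :=
  (8 : ℂ)⁻¹ * (elems.map (fun g =>
    (((1 - mat g).det : ℝ) : ℂ) * (starRingEnd ℂ) (f g) * f' g)).sum

/-- The space of virtual characters of `W₀`. -/
def charSpaceW0 : Submodule ℂ (↥W0 → ℂ) :=
  Submodule.span ℂ {f | ∃ W : FDRep ℂ ↥W0, f = FDRep.character W}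

/-- The induced character from a subgroup (summed over cosets). -/
def indChar (H : Subgroup ↥W0) (f : ↥H → ℂ) : ↥W0 → ℂ :=
  fun γ => ∑ᶠ c : ↥W0 ⧸ H,
    (if h : (Quotient.out c)⁻¹ * γ * (Quotient.out c) ∈ H then
      f ⟨(Quotient.out c)⁻¹ * γ * (Quotient.out c), h⟩ else 0)

/-- `Σ_H Ind_H^{W₀} G_ℂ(H)` over the subgroups `H` having a nonzero fixed
vector in `E = ℝ²`. -/
def indSubW0 : Submodule ℂ (↥W0 → ℂ) :=
  Submodule.span ℂ {f | ∃ H : Subgroup ↥W0,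
    (∃ v : Fin 2 → ℝ, v ≠ 0 ∧ ∀ h ∈ H, (mat h).mulVec v = v) ∧
    ∃ W : FDRep ℂ ↥H, f = indChar H (FDRep.character W)}

lemma mat_one : mat 1 = !![1, 0; 0, 1] := by
  simp [mat, Matrix.one_fin_two]

lemma mat_mul (g h : ↥W0) : mat (g * h) = mat g * mat h := by
  simp [mat]

lemma mat_a : mat a = !![0, 1; 1, 0] := rfl

lemma mat_b : mat b = !![1, 0; 0, -1] := rfl

lemma mat_inj {g h : ↥W0} (e : mat g = mat h) : g = h :=
  Subtype.ext (Units.ext e)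

lemma mat_ab : mat (a * b) = !![0, -1; 1, 0] := by
  simp [mat_mul, mat_a, mat_b]
lemma mat_ba : mat (b * a) = !![0, 1; -1, 0] := by
  simp [mat_mul, mat_a, mat_b]
lemma mat_aba : mat (a * b * a) = !![-1, 0; 0, 1] := by
  simp [mat_mul, mat_a, mat_b]
lemma mat_bab : mat (b * a * b) = !![0, -1; -1, 0] := by
  simp [mat_mul, mat_a, mat_b]
lemma mat_abab : mat (a * b * a * b) = !![-1, 0; 0, -1] := by
  simp [mat_mul, mat_a, mat_b]

lemma aa : a * a = 1 := by
  apply mat_inj; rw [mat_mul, mat_a, mat_one]; simp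
lemma bb : b * b = 1 := by
  apply mat_inj; rw [mat_mul, mat_b, mat_one]; simp

lemma S1_inv_eq : S1⁻¹ = S1 := rfl
lemma S2_inv_eq : S2⁻¹ = S2 := rfl

lemma mat_cases_GL (g : GL (Fin 2) ℝ) (hg : g ∈ Subgroup.closure {S1, S2}) :
    g.val = !![1, 0; 0, 1] ∨ g.val = !![0, 1; 1, 0] ∨ g.val = !![1, 0; 0, -1] ∨
    g.val = !![0, -1; 1, 0] ∨ g.val = !![0, 1; -1, 0] ∨ g.val = !![-1, 0; 0, 1] ∨
    g.val = !![0, -1; -1, 0] ∨ g.val = !![-1, 0; 0, -1] := by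
  have key : ∀ (x : GL (Fin 2) ℝ), ∀ y ∈ ({S1, S2} : Set (GL (Fin 2) ℝ)),
      (x.val = !![1, 0; 0, 1] ∨ x.val = !![0, 1; 1, 0] ∨ x.val = !![1, 0; 0, -1] ∨
      x.val = !![0, -1; 1, 0] ∨ x.val = !![0, 1; -1, 0] ∨ x.val = !![-1, 0; 0, 1] ∨
      x.val = !![0, -1; -1, 0] ∨ x.val = !![-1, 0; 0, -1]) →
      ((x * y).val = !![1, 0; 0, 1] ∨ (x * y).val = !![0, 1; 1, 0] ∨
      (x * y).val = !![1, 0; 0, -1] ∨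
      (x * y).val = !![0, -1; 1, 0] ∨ (x * y).val = !![0, 1; -1, 0] ∨
      (x * y).val = !![-1, 0; 0, 1] ∨
      (x * y).val = !![0, -1; -1, 0] ∨ (x * y).val = !![-1, 0; 0, -1]) := by
    intro x y hy h
    have e1 : S1.val = !![0, 1; 1, 0] := rfl
    have e2 : S2.val = !![1, 0; 0, -1] := rfl
    rw [Units.val_mul]
    rcases hy with rfl | rfl <;> simp only [e1, e2] <;>
      rcases h with h | h | h | h | h | h | h | h <;> rw [h] <;> simp
  induction hg using Subgroup.closure_induction_right with
  | one => left; simp [Matrix.one_fin_two]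
  | mul_right x hx y hy ih => exact key x y hy ih
  | mul_inv_cancel x hx y hy ih =>
    have : y⁻¹ = y := by rcases hy with rfl | rfl <;> rfl
    rw [this]; exact key x y hy ih

lemma mem_cases (g : ↥W0) : g = 1 ∨ g = a ∨ g = b ∨ g = a * b ∨ g = b * a ∨
    g = a * b * a ∨ g = b * a * b ∨ g = a * b * a * b := by
  rcases mat_cases_GL g.1 g.2 with h | h | h | h | h | h | h | h
  · exact Or.inl (mat_inj (by rw [mat_one]; exact h))
  · exact Or.inr (Or.inl (mat_inj h))
  · exact Or.inr (Or.inr (Or.inl (mat_inj h)))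
  · exact Or.inr (Or.inr (Or.inr (Or.inl (mat_inj (by rw [mat_ab]; exact h)))))
  · exact Or.inr (Or.inr (Or.inr (Or.inr (Or.inl (mat_inj (by rw [mat_ba]; exact h))))))
  · exact Or.inr (Or.inr (Or.inr (Or.inr (Or.inr (Or.inl
      (mat_inj (by rw [mat_aba]; exact h)))))))
  · exact Or.inr (Or.inr (Or.inr (Or.inr (Or.inr (Or.inr (Or.inl
      (mat_inj (by rw [mat_bab]; exact h))))))))
  · exact Or.inr (Or.inr (Or.inr (Or.inr (Or.inr (Or.inr (Or.inr
      (mat_inj (by rw [mat_abab]; exact h))))))))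

instance finite_W0 : Finite ↥W0 := by
  have : (Set.univ : Set ↥W0) ⊆ {x | x ∈ elems} := by
    intro g _
    have := mem_cases g
    simpa [elems] using this
  exact Set.finite_univ_iff.mp ((List.finite_toSet elems).subset this)

/-- The stabilizer of a vector. -/
def stab (v : Fin 2 → ℝ) : Subgroup ↥W0 where
  carrier := {g | (mat g).mulVec v = v}
  one_mem' := Matrix.one_mulVec v
  mul_mem' := by
    intro x y hx hy
    simp only [Set.mem_ofPred_eq] at *
    rw [mat_mul, ← Matrix.mulVec_mulVec, hy, hx]
  inv_mem' := by
    intro x hx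
    simp only [Set.mem_ofPred_eq] at *
    nth_rewrite 1 [← hx]
    rw [Matrix.mulVec_mulVec, ← mat_mul, inv_mul_cancel]
    simp [mat]

lemma mem_stab (v : Fin 2 → ℝ) (g : ↥W0) : g ∈ stab v ↔ (mat g).mulVec v = v := Iff.rfl

lemma conj_fix {v : Fin 2 → ℝ} {x g : ↥W0}
    (h : (mat (x⁻¹ * g * x)).mulVec v = v) :
    (mat g).mulVec ((mat x).mulVec v) = (mat x).mulVec v := by
  nth_rewrite 2 [← h]
  rw [Matrix.mulVec_mulVec, Matrix.mulVec_mulVec, ← mat_mul, ← mat_mul]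
  congr 2; group

/-- The permutation character. -/
def F (v : Fin 2 → ℝ) : ↥W0 → ℂ := indChar (stab v) (fun _ => 1)

lemma F_eq (v : Fin 2 → ℝ) (g : ↥W0) :
    F v g = ∑ᶠ c : ↥W0 ⧸ stab v, (if g • c = c then (1 : ℂ) else 0) := by
  unfold F indChar
  apply finsum_congr
  intro c
  have : (Quotient.out c)⁻¹ * g * (Quotient.out c) ∈ stab v ↔ g • c = c := by
    have h1 : ((Quotient.out c : ↥W0) : ↥W0 ⧸ stab v) = c := Quotient.out_eq' c
    have h2 : g • c = ((g * Quotient.out c : ↥W0) : ↥W0 ⧸ stab v) := by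
      conv_lhs => rw [← h1]
      rfl
    rw [h2]
    conv_rhs => rhs; rw [← h1]
    rw [eq_comm, QuotientGroup.eq, mul_assoc]
  by_cases h : g • c = c
  · rw [dif_pos (this.2 h), if_pos h]
  · rw [dif_neg (fun h' => h (this.1 h')), if_neg h]

lemma F_conj (v : Fin 2 → ℝ) (g x : ↥W0) : F v (x * g * x⁻¹) = F v g := by
  rw [F_eq, F_eq, ← finsum_comp_equiv (MulAction.toPerm x)]
  apply finsum_congr
  intro c
  have : (x * g * x⁻¹) • (MulAction.toPerm x) c = (MulAction.toPerm x) c ↔ g • c = c := by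
    simp only [MulAction.toPerm_apply, smul_smul, inv_mul_cancel_right]
    rw [mul_smul]
    exact smul_left_cancel_iff x
  simp only [this]

lemma F_zero (v : Fin 2 → ℝ) (g : ↥W0)
    (h : ∀ x : ↥W0, (mat g).mulVec ((mat x).mulVec v) ≠ (mat x).mulVec v) : F v g = 0 := by
  unfold F indChar
  apply finsum_eq_zero_of_forall_eq_zero
  intro c
  rw [dif_neg]
  intro hc
  exact h _ (conj_fix hc)

lemma F_ne (v : Fin 2 → ℝ) (g : ↥W0) (h : (mat g).mulVec v = v) : F v g ≠ 0 := by
  rw [F_eq]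
  have : Fintype (↥W0 ⧸ stab v) := Fintype.ofFinite _
  rw [finsum_eq_sum_of_fintype, Finset.sum_boole]
  have : ((1 : ↥W0) : ↥W0 ⧸ stab v) ∈
      Finset.univ.filter (fun c : ↥W0 ⧸ stab v => g • c = c) := by
    simp only [Finset.mem_filter, Finset.mem_univ, true_and]
    change ((g * 1 : ↥W0) : ↥W0 ⧸ stab v) = _
    rw [eq_comm, QuotientGroup.eq]
    simpa [mem_stab] using h
  exact_mod_cast (Finset.card_pos.2 ⟨_, this⟩).ne'

lemma triv_char (H : Type) [Group H] :
    FDRep.character (FDRep.of (Representation.trivial ℂ H ℂ)) = fun _ => 1 := by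
  funext g
  change LinearMap.trace ℂ ℂ (LinearMap.id) = 1
  simp

lemma F_mem (v : Fin 2 → ℝ) (hv : v ≠ 0) : F v ∈ indSubW0 :=
  Submodule.subset_span ⟨stab v, ⟨v, hv, fun _ h => h⟩,
    FDRep.of (Representation.trivial ℂ _ ℂ), by rw [triv_char]; rfl⟩

lemma no_fix_ab (w : Fin 2 → ℝ) (h : (mat (a * b)).mulVec w = w) : w = 0 := by
  rw [mat_ab] at h
  have h0 := congrFun h 0
  have h1 := congrFun h 1
  simp [Matrix.mulVec, dotProduct, Fin.sum_univ_two] at h0 h1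
  ext i; fin_cases i <;> simp <;> linarith

lemma no_fix_abab (w : Fin 2 → ℝ) (h : (mat (a * b * a * b)).mulVec w = w) : w = 0 := by
  rw [mat_abab] at h
  have h0 := congrFun h 0
  have h1 := congrFun h 1
  simp [Matrix.mulVec, dotProduct, Fin.sum_univ_two] at h0 h1
  ext i; fin_cases i <;> simp <;> linarith

lemma mat_smul_ne (x : ↥W0) {v : Fin 2 → ℝ} (hv : v ≠ 0) : (mat x).mulVec v ≠ 0 := by
  intro h
  apply hv
  have : (mat x⁻¹).mulVec ((mat x).mulVec v) = v := by
    rw [Matrix.mulVec_mulVec, ← mat_mul, inv_mul_cancel]; simp [mat]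
  rw [← this, h, Matrix.mulVec_zero]

lemma ind_vanish (f : ↥W0 → ℂ) (hf : f ∈ indSubW0) :
    f (a * b) = 0 ∧ f (a * b * a * b) = 0 := by
  induction hf using Submodule.span_induction with
  | mem f hf =>
    obtain ⟨H, ⟨v, hv, hH⟩, W, rfl⟩ := hf
    constructor
    · apply finsum_eq_zero_of_forall_eq_zero
      intro c
      rw [dif_neg]
      intro hc
      exact mat_smul_ne _ hv (no_fix_ab _ (conj_fix (hH _ hc)))
    · apply finsum_eq_zero_of_forall_eq_zero
      intro c
      rw [dif_neg]
      intro hc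
      exact mat_smul_ne _ hv (no_fix_abab _ (conj_fix (hH _ hc)))
  | zero => simp
  | add f g _ _ hf hg => simp [hf.1, hf.2, hg.1, hg.2]
  | smul c f _ hf => simp [hf.1, hf.2]

lemma char_conj' (f : ↥W0 → ℂ) (hf : f ∈ charSpaceW0) (g x : ↥W0) :
    f (x * g * x⁻¹) = f g := by
  induction hf using Submodule.span_induction with
  | mem f hf => obtain ⟨W, rfl⟩ := hf; exact FDRep.char_conj W g x
  | zero => simp
  | add f g _ _ hf hg => simp only [Pi.add_apply, hf, hg]
  | smul c f _ hf => simp only [Pi.smul_apply, hf]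

lemma a_inv : a⁻¹ = a := rfl
lemma b_inv : b⁻¹ = b := rfl

lemma class_zero (f : ↥W0 → ℂ) (hf : ∀ g x, f (x * g * x⁻¹) = f g)
    (h1 : f 1 = 0) (ha : f a = 0) (hb : f b = 0) (hab : f (a * b) = 0)
    (hc : f (a * b * a * b) = 0) : f = 0 := by
  funext g
  rcases mem_cases g with rfl | rfl | rfl | rfl | rfl | rfl | rfl | rfl
  · exact h1
  · exact ha
  · exact hb
  · exact hab
  · have := hf (a * b) a
    rw [a_inv, ← mul_assoc, aa, one_mul] at this
    exact this.trans hab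
  · have := hf b a
    rw [a_inv] at this; exact this.trans hb
  · have := hf a b
    rw [b_inv] at this; exact this.trans ha
  · exact hc

lemma mv2 (x y z w p q : ℝ) :
    (!![x, y; z, w] : Matrix (Fin 2) (Fin 2) ℝ).mulVec ![p, q] =
      ![x * p + y * q, z * p + w * q] := by
  ext i
  fin_cases i <;> simp [Matrix.mulVec, dotProduct, Fin.sum_univ_two]

lemma vec_cases (x : ↥W0) (p q : ℝ) :
    (mat x).mulVec ![p, q] = ![p, q] ∨ (mat x).mulVec ![p, q] = ![q, p] ∨
    (mat x).mulVec ![p, q] = ![p, -q] ∨ (mat x).mulVec ![p, q] = ![-q, p] ∨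
    (mat x).mulVec ![p, q] = ![q, -p] ∨ (mat x).mulVec ![p, q] = ![-p, q] ∨
    (mat x).mulVec ![p, q] = ![-q, -p] ∨ (mat x).mulVec ![p, q] = ![-p, -q] := by
  rcases mem_cases x with rfl | rfl | rfl | rfl | rfl | rfl | rfl | rfl <;>
    simp only [mat_one, mat_a, mat_b, mat_ab, mat_ba, mat_aba, mat_bab, mat_abab, mv2] <;> simp

lemma fix_a {p q : ℝ} : (mat a).mulVec ![p, q] = ![p, q] ↔ p = q := by
  rw [mat_a]
  constructor
  · intro h
    have := congrFun h 1
    simpa using this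
  · rintro rfl; simp [mv2, -Matrix.mulVec_cons]

lemma fix_b {p q : ℝ} : (mat b).mulVec ![p, q] = ![p, q] ↔ q = 0 := by
  rw [mat_b]
  constructor
  · intro h
    have := congrFun h 1
    simp at this
    linarith
  · rintro rfl; simp [mv2, -Matrix.mulVec_cons]

lemma mem_ind (f : ↥W0 → ℂ) (hf : f ∈ charSpaceW0) (hab : f (a * b) = 0)
    (hc : f (a * b * a * b) = 0) : f ∈ indSubW0 := by
  have n1 : (![1, 1] : Fin 2 → ℝ) ≠ 0 := fun h => by simpa using congrFun h 0
  have n2 : (![1, 0] : Fin 2 → ℝ) ≠ 0 := fun h => by simpa using congrFun h 0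
  have n3 : (![1, 2] : Fin 2 → ℝ) ≠ 0 := fun h => by simpa using congrFun h 0
  have zab : ∀ v, v ≠ 0 → F v (a * b) = 0 := fun v hv =>
    F_zero _ _ fun x h => mat_smul_ne x hv (no_fix_ab _ h)
  have zc : ∀ v, v ≠ 0 → F v (a * b * a * b) = 0 := fun v hv =>
    F_zero _ _ fun x h => mat_smul_ne x hv (no_fix_abab _ h)
  have z1b : F ![1, 1] b = 0 := F_zero _ _ fun x h => by
    rcases vec_cases x 1 1 with e | e | e | e | e | e | e | e <;>
      rw [e, fix_b] at h <;> norm_num at h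
  have z2a : F ![1, 0] a = 0 := F_zero _ _ fun x h => by
    rcases vec_cases x 1 0 with e | e | e | e | e | e | e | e <;>
      rw [e, fix_a] at h <;> norm_num at h
  have z3a : F ![1, 2] a = 0 := F_zero _ _ fun x h => by
    rcases vec_cases x 1 2 with e | e | e | e | e | e | e | e <;>
      rw [e, fix_a] at h <;> norm_num at h
  have z3b : F ![1, 2] b = 0 := F_zero _ _ fun x h => by
    rcases vec_cases x 1 2 with e | e | e | e | e | e | e | e <;>
      rw [e, fix_b] at h <;> norm_num at h
  have m1 : F ![1, 1] a ≠ 0 := F_ne _ _ (fix_a.2 rfl)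
  have m2 : F ![1, 0] b ≠ 0 := F_ne _ _ (fix_b.2 rfl)
  have m3 : F ![1, 2] 1 ≠ 0 := F_ne _ _ (by simp [mat])
  set α := f a / F ![1, 1] a with hα
  set β := f b / F ![1, 0] b with hβ
  set δ := (f 1 - α * F ![1, 1] 1 - β * F ![1, 0] 1) / F ![1, 2] 1 with hδ
  have eα : α * F ![1, 1] a = f a := div_mul_cancel₀ _ m1
  have eβ : β * F ![1, 0] b = f b := div_mul_cancel₀ _ m2
  have eδ : δ * F ![1, 2] 1 = f 1 - α * F ![1, 1] 1 - β * F ![1, 0] 1 := div_mul_cancel₀ _ m3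
  have key : f - (α • F ![1, 1] + β • F ![1, 0] + δ • F ![1, 2]) = 0 := by
    apply class_zero
    · intro g x
      simp only [Pi.sub_apply, Pi.add_apply, Pi.smul_apply, F_conj, char_conj' f hf]
    · simp only [Pi.sub_apply, Pi.add_apply, Pi.smul_apply, smul_eq_mul, eδ]; ring
    · simp only [Pi.sub_apply, Pi.add_apply, Pi.smul_apply, smul_eq_mul, eα, z2a, z3a]; ring
    · simp only [Pi.sub_apply, Pi.add_apply, Pi.smul_apply, smul_eq_mul, eβ, z1b, z3b]; ring
    · simp [zab _ n1, zab _ n2, zab _ n3, hab]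
    · simp [zc _ n1, zc _ n2, zc _ n3, hc]
  rw [sub_eq_zero.1 key]
  exact add_mem (add_mem (Submodule.smul_mem _ _ (F_mem _ n1))
    (Submodule.smul_mem _ _ (F_mem _ n2))) (Submodule.smul_mem _ _ (F_mem _ n3))

lemma eps0_mem : eps0 ∈ charSpaceW0 :=
  Submodule.subset_span ⟨FDRep.of (Representation.trivial ℂ _ ℂ), by rw [triv_char]; rfl⟩

/-- The complexified reflection representation. -/
def repE : Representation ℂ ↥W0 (Fin 2 → ℂ) where
  toFun g := Matrix.toLin' ((mat g).map Complex.ofRealHom)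
  map_one' := by
    rw [mat_one, ← Matrix.one_fin_two, Matrix.map_one _ (map_zero _) (map_one _),
      Matrix.toLin'_one]; rfl
  map_mul' x y := by
    rw [mat_mul, Matrix.map_mul, Matrix.toLin'_mul]; rfl

lemma chiE_mem : chiE ∈ charSpaceW0 := by
  refine Submodule.subset_span ⟨FDRep.of repE, ?_⟩
  funext g
  change _ = LinearMap.trace ℂ (Fin 2 → ℂ) (Matrix.toLin' ((mat g).map Complex.ofRealHom))
  rw [Matrix.trace_toLin'_eq]
  simp [chiE, Matrix.trace, Fin.sum_univ_two]

/-- Evaluation at the elliptic classes. -/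
def ev : ↥charSpaceW0 →ₗ[ℂ] (Fin 2 → ℂ) where
  toFun f := ![f.1 (a * b), f.1 (a * b * a * b)]
  map_add' f g := by simp
  map_smul' c f := by simp

lemma ev_ker : indSubW0.comap charSpaceW0.subtype = LinearMap.ker ev := by
  ext f
  rw [Submodule.mem_comap, LinearMap.mem_ker]
  constructor
  · intro h
    obtain ⟨h1, h2⟩ := ind_vanish _ h
    simp only [Submodule.subtype_apply] at h1 h2
    simp [ev, h1, h2]
  · intro h
    exact mem_ind f.1 f.2 (congrFun h 0) (congrFun h 1)

lemma ev_surj : Function.Surjective ev := by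
  intro w
  refine ⟨w 0 • ⟨eps0, eps0_mem⟩ + ((w 0 - w 1) / 2) • ⟨chiE, chiE_mem⟩, ?_⟩
  have e1 : chiE (a * b) = 0 := by simp [chiE, mat_ab, Matrix.trace_fin_two]
  have e2 : chiE (a * b * a * b) = -2 := by
    simp [chiE, mat_abab, Matrix.trace_fin_two]; norm_num
  ext i
  fin_cases i
  · simp [ev, e1, eps0]
  · simp [ev, e2, eps0]

lemma ell_dim : Module.finrank ℂ
    (↥charSpaceW0 ⧸ indSubW0.comap charSpaceW0.subtype) = 2 := by
  rw [ev_ker, (LinearMap.quotKerEquivOfSurjective ev ev_surj).finrank_eq]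
  simp

lemma eB2_eq (f f' : ↥W0 → ℂ) : eB2 f f' = (8 : ℂ)⁻¹ *
    (2 * (starRingEnd ℂ) (f (a * b)) * f' (a * b) +
     2 * (starRingEnd ℂ) (f (b * a)) * f' (b * a) +
     4 * (starRingEnd ℂ) (f (a * b * a * b)) * f' (a * b * a * b)) := by
  have d1 : (1 - mat 1).det = 0 := by rw [mat_one]; simp [Matrix.det_fin_two]
  have d2 : (1 - mat a).det = 0 := by rw [mat_a]; simp [Matrix.det_fin_two]
  have d3 : (1 - mat b).det = 0 := by rw [mat_b]; simp [Matrix.det_fin_two]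
  have d4 : (1 - mat (a * b)).det = 2 := by
    rw [mat_ab]; simp [Matrix.det_fin_two]; norm_num
  have d5 : (1 - mat (b * a)).det = 2 := by
    rw [mat_ba]; simp [Matrix.det_fin_two]; norm_num
  have d6 : (1 - mat (a * b * a)).det = 0 := by rw [mat_aba]; simp [Matrix.det_fin_two]
  have d7 : (1 - mat (b * a * b)).det = 0 := by rw [mat_bab]; simp [Matrix.det_fin_two]
  have d8 : (1 - mat (a * b * a * b)).det = 4 := by
    rw [mat_abab]; simp [Matrix.det_fin_two]; norm_num
  simp only [eB2, elems, List.map_cons, List.map_nil, List.sum_cons, List.sum_nil,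
    d1, d2, d3, d4, d5, d6, d7, d8]
  push_cast
  ring

/-- The elliptic pairing table of `W₀(B₂)` on the five
irreducible characters `ε₀, ε₁, ε₂, ε₃, E`, and `dim Ell(W₀) = 2`. -/
theorem elliptic_pairing_table_B2 :
    eB2 eps0 eps0 = 1 ∧ eB2 eps3 eps3 = 1 ∧ eB2 eps0 eps3 = 1 ∧
    eB2 eps1 eps1 = 1 ∧ eB2 eps2 eps2 = 1 ∧ eB2 eps1 eps2 = 1 ∧
    eB2 eps0 eps1 = 0 ∧ eB2 eps0 eps2 = 0 ∧ eB2 eps1 eps3 = 0 ∧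
    eB2 eps2 eps3 = 0 ∧
    eB2 eps0 chiE = -1 ∧ eB2 eps1 chiE = -1 ∧ eB2 eps2 chiE = -1 ∧
    eB2 eps3 chiE = -1 ∧ eB2 chiE chiE = 2 ∧
    Module.finrank ℂ
      (↥charSpaceW0 ⧸ indSubW0.comap charSpaceW0.subtype) = 2 := by
  refine ⟨?_, ?_, ?_, ?_, ?_, ?_, ?_, ?_, ?_, ?_, ?_, ?_, ?_, ?_, ?_, ell_dim⟩ <;>
    rw [eB2_eq] <;>
    simp [eps0, eps1, eps2, eps3, chiE, mat_ab, mat_ba, mat_abab, Matrix.trace_fin_two,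
      Matrix.det_fin_two] <;> norm_num

end
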